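/- Let P be a linearly ordered set and n ≥ 2, and for 1 ≤ c ≤ n−1 let m_c be the operator on P^n with m_c(d) equal to d with d_c and d_{c+1} interchanged if d_c > d_{c+1}, and m_c(d) = d otherwise. Let (x₀,…,x_{k+2}; y₀,…,y_{k+1}; z₀,…,z_k), k ≥ 0, be nonnegative integers satisfying x_j ≥ y_j > x_{j+1} for 0 ≤ j ≤ k+1 and y_j > z_j ≥ y_{j+1} for 0 ≤ j ≤ k (a Δ-then-Γ short pattern), and let y'_j be defined by y'₀ = x₀ + max(x₁, z₀) − y₀, y'_j = min(x_j, z_{j−1}) + max(x_{j+1}, z_j) − y_j for 1 ≤ j ≤ k, and y'_{k+1} = min(x_{k+1}, z_k) + x_{k+2} − y_{k+1}. Assume n ≥ k+3 and define: H_Δ = { j+1 : 0 ≤ j ≤ k+1, x_j = y_j }, H_Γ = { j+2 : 0 ≤ j ≤ k, z_j = y_{j+1} }, H'_Γ = { j+1 : 0 ≤ j ≤ k+1, y'_j = x_{j+1} }, H'_Δ = { j+1 : 0 ≤ j ≤ k, y'_j = z_j }. Let G : P^n → P^n be the map that first applies the operators m_c for c ∈ H_Δ in decreasing order of c (largest index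 first), and then applies the operators m_c for c ∈ H_Γ in increasing order of c (smallest index first); and let G' : P^n → P^n be the map that first applies the operators m_c for c ∈ H'_Γ in increasing order of c, and then applies the operators m_c for c ∈ H'_Δ in decreasing order of c. Then G = G'. -/

import Mathlib

namespace CoxeterMonoid

/-- The bubble-sort operator `m_c` (`1 ≤ c ≤ n−1`, `1`-based positions) on `n`-tuples over a
linearly ordered set. -/
def bop (P : Type*) [LinearOrder P] (n : ℕ) (c : ℕ) (d : Fin n → P) : Fin n → P :=
  if h : 1 ≤ c ∧ c < n then
    (if d ⟨c, h.2⟩ < d ⟨c - 1, by omega⟩ then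
      d ∘ Equiv.swap (⟨c - 1, by omega⟩ : Fin n) ⟨c, h.2⟩
    else d)
  else d

/-- Apply the operators `m_c` for `c` in the list `L`, from the head of the list onwards. -/
def applyOps (P : Type*) [LinearOrder P] (n : ℕ) (L : List ℕ) (d : Fin n → P) : Fin n → P :=
  L.foldl (fun acc c => bop P n c acc) d

/-- The middle row of `t_short 𝔱` for a short pattern with rows
`(x₀,…,x_{k+2}; y₀,…,y_{k+1}; z₀,…,z_k)`. -/
def tshort (k : ℕ) (x y z : ℕ → ℕ) : ℕ → ℕ := fun j =>
  if j = 0 then x 0 + max (x 1) (z 0) - y 0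
  else if j = k + 1 then min (x (k + 1)) (z k) + x (k + 2) - y (k + 1)
  else min (x j) (z (j - 1)) + max (x (j + 1)) (z j) - y j

section OrderedProducts

variable {M : Type*} [Monoid M] (m : ℕ → M)

/-- The product of the `m c`, for `c ∈ S` with `i ≤ c < i + l`, in increasing order of `c`. -/
def ascProd (S : Finset ℕ) (i l : ℕ) : M :=
  (((List.range' i l).filter (· ∈ S)).map m).prod

/-- The product of the `m c`, for `c ∈ S` with `i ≤ c < i + l`, in decreasing order of `c`. -/
def descProd (S : Finset ℕ) (i l : ℕ) : M :=
  (((List.range' i l).filter (· ∈ S)).reverse.map m).prod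

theorem ascProd_succ (S : Finset ℕ) (i l : ℕ) :
    ascProd m S i (l + 1) = (if i ∈ S then m i else 1) * ascProd m S (i + 1) l := by
  by_cases h : i ∈ S <;> simp [ascProd, List.range'_succ, h]

theorem descProd_succ (S : Finset ℕ) (i l : ℕ) :
    descProd m S i (l + 1) = descProd m S (i + 1) l * (if i ∈ S then m i else 1) := by
  by_cases h : i ∈ S <;> simp [descProd, List.range'_succ, h]

variable {m}

theorem commute_ascProd (hcomm : ∀ i j, i + 2 ≤ j → Commute (m i) (m j)) {S : Finset ℕ}
    {i j : ℕ} (l : ℕ) (hj : i + 1 ≤ j) (hS : i + 1 = j → j ∉ S) :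
    Commute (m i) (ascProd m S j l) := by
  refine Commute.list_prod_right _ _ fun a ha => ?_
  simp only [List.mem_map, List.mem_filter, List.mem_range'_1, decide_eq_true_eq] at ha
  obtain ⟨c, ⟨⟨hc, -⟩, hcS⟩, rfl⟩ := ha
  refine hcomm i c ?_
  grind

theorem commute_descProd (hcomm : ∀ i j, i + 2 ≤ j → Commute (m i) (m j)) {S : Finset ℕ}
    {i j : ℕ} (l : ℕ) (hj : i + 1 ≤ j) (hS : i + 1 = j → j ∉ S) :
    Commute (m i) (descProd m S j l) := by
  refine Commute.list_prod_right _ _ fun a ha => ?_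
  simp only [List.mem_map, List.mem_reverse, List.mem_filter, List.mem_range'_1,
    decide_eq_true_eq] at ha
  obtain ⟨c, ⟨⟨hc, -⟩, hcS⟩, rfl⟩ := ha
  refine hcomm i c ?_
  grind

/-- In a monoid with generators satisfying the 0-Hecke relations, a decreasing product over `A`
followed by an increasing product over `B` can be rewritten as an increasing product over `B'`
followed by a decreasing product over `A'`, provided `A ∪ B = A' ∪ B'` and, along runs of consecutive
elements of this union, `A'` and `B'` are the shifts of `A` and `B`. The second conjunct is the
form the induction needs. -/
theorem descProd_mul_ascProd_aux (hidem : ∀ i, m i * m i = m i)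
    (hcomm : ∀ i j, i + 2 ≤ j → Commute (m i) (m j))
    (hbraid : ∀ i, m (i + 1) * m i * m (i + 1) = m i * m (i + 1) * m i)
    {A B A' B' : Finset ℕ} {N : ℕ} (hE : A ∪ B = A' ∪ B') (hN : ∀ i ∈ A ∪ B, i < N)
    (hA : ∀ i, i ∈ A ∪ B → i + 1 ∈ A ∪ B → (i ∈ A' ↔ i + 1 ∈ A))
    (hB : ∀ i, i ∈ A ∪ B → i + 1 ∈ A ∪ B → (i ∈ B' ↔ i + 1 ∈ B)) (l : ℕ) :
    ∀ i, i + l = N →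
      descProd m A i l * ascProd m B i l = ascProd m B' i l * descProd m A' i l ∧
      (i ∈ A ∪ B → descProd m A (i + 1) (l - 1) * m i * ascProd m B (i + 1) (l - 1) =
        ascProd m B' i l * descProd m A' i l) := by
  induction l with
  | zero =>
    intro i hi
    refine ⟨by simp [ascProd, descProd], fun h => ?_⟩
    have := hN i h
    omega
  | succ l ih =>
    intro i hi
    obtain ⟨ih₁, ih₂⟩ := ih (i + 1) (by omega)
    have key : i ∈ A ∪ B → descProd m A (i + 1) l * m i * ascProd m B (i + 1) l =
        ascProd m B' i (l + 1) * descProd m A' i (l + 1) := by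
      intro hiE
      by_cases hsE : i + 1 ∈ A ∪ B
      · have hlt := hN _ hsE
        obtain ⟨l, rfl⟩ : ∃ l', l = l' + 1 := ⟨l - 1, by omega⟩
        have hT := ih₂ hsE
        rw [Nat.add_sub_cancel] at hT
        have hcA := (commute_descProd hcomm (S := A) (i := i) (j := i + 1 + 1) l
          (by omega) (by omega)).eq
        have hcB := (commute_ascProd hcomm (S := B) (i := i) (j := i + 1 + 1) l
          (by omega) (by omega)).eq
        rw [ascProd_succ m B', descProd_succ m A' i, descProd_succ m A, ascProd_succ m B]
        set a := descProd m A (i + 1 + 1) l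
        set b := ascProd m B (i + 1 + 1) l
        simp only [hA i hiE hsE, hB i hiE hsE]
        calc _ = (if i + 1 ∈ B then m i else 1) * (a * m (i + 1) * b) *
              (if i + 1 ∈ A then m i else 1) := ?_
          _ = _ := by rw [hT]; simp only [mul_assoc]
        by_cases hsA : i + 1 ∈ A <;> by_cases hsB : i + 1 ∈ B
        · simp only [hsA, hsB, if_true]
          calc _ = a * (m (i + 1) * m i * m (i + 1)) * b := by simp only [mul_assoc]
            _ = (a * m i) * m (i + 1) * (m i * b) := by rw [hbraid]; simp only [mul_assoc]
            _ = _ := by rw [← hcA, hcB]; simp only [mul_assoc]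
        · simp only [hsA, hsB, if_true, if_false, one_mul, mul_assoc, hcB]
        · simp only [hsA, hsB, if_true, if_false, mul_one]
          rw [← hcA]; simp only [mul_assoc]
        · exact absurd (Finset.mem_union.1 hsE) (by tauto)
      · have hsE' := hsE
        rw [hE] at hsE'
        simp only [Finset.mem_union, not_or] at hsE hsE'
        have hcA := (commute_descProd hcomm (S := A) (i := i) (j := i + 1) l
          le_rfl fun _ => hsE.1).eq
        have hcA' := (commute_descProd hcomm (S := A') (i := i) (j := i + 1) l
          le_rfl fun _ => hsE'.1).eq
        have hcB' := (commute_ascProd hcomm (S := B') (i := i) (j := i + 1) l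
          le_rfl fun _ => hsE'.2).eq
        rw [ascProd_succ, descProd_succ, ← hcA, mul_assoc, ih₁]
        by_cases hiA : i ∈ A' <;> by_cases hiB : i ∈ B'
        · simp only [hiA, hiB, if_true]
          rw [← hcA']
          calc _ = (m i * m i) * (ascProd m B' (i + 1) l * descProd m A' (i + 1) l) := by
                rw [hidem]
            _ = m i * (m i * ascProd m B' (i + 1) l) * descProd m A' (i + 1) l := by
                simp only [mul_assoc]
            _ = m i * (ascProd m B' (i + 1) l * m i) * descProd m A' (i + 1) l := by
                rw [hcB']
            _ = _ := by simp only [mul_assoc]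
        · simp only [hiA, hiB, if_true, if_false, one_mul]
          rw [← hcA', ← mul_assoc, hcB', mul_assoc]
        · simp only [hiA, hiB, if_true, if_false, mul_one, mul_assoc]
        · rw [hE] at hiE
          exact absurd (Finset.mem_union.1 hiE) (by tauto)
    refine ⟨?_, key⟩
    by_cases hiE : i ∈ A ∪ B
    · rw [← key hiE, descProd_succ m A, ascProd_succ m B]
      by_cases hiA : i ∈ A <;> by_cases hiB : i ∈ B
      · simp only [hiA, hiB, if_true]
        calc _ = descProd m A (i + 1) l * (m i * m i) * ascProd m B (i + 1) l := by
              simp only [mul_assoc]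
          _ = _ := by rw [hidem]
      · simp only [hiA, hiB, if_true, if_false, one_mul]
      · simp only [hiA, hiB, if_true, if_false, mul_one, mul_assoc]
      · exact absurd (Finset.mem_union.1 hiE) (by tauto)
    · have hiE' := hiE
      rw [hE] at hiE'
      simp only [Finset.mem_union, not_or] at hiE hiE'
      simp only [ascProd_succ, descProd_succ, hiE, hiE', if_false, one_mul, mul_one, ih₁]

end OrderedProducts

section BubbleSort

variable {P : Type*} [LinearOrder P] {n : ℕ}

theorem bop_apply {c : ℕ} (h : 1 ≤ c ∧ c < n) (d : Fin n → P) (i : Fin n) :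
    bop P n c d i =
      if (i : ℕ) = c - 1 then min (d ⟨c - 1, by omega⟩) (d ⟨c, h.2⟩)
      else if (i : ℕ) = c then max (d ⟨c - 1, by omega⟩) (d ⟨c, h.2⟩) else d i := by
  obtain ⟨i, hi⟩ := i
  have h₁ := h.1
  simp only [bop, h, and_self, dif_pos]
  split_ifs with h₂ h₃ h₄ h₃ h₄
  · subst h₃
    simp [min_eq_right h₂.le]
  · subst h₄
    simp [max_eq_left h₂.le]
  · simp [Equiv.swap_apply_of_ne_of_ne, Fin.ext_iff, h₃, h₄]
  · subst h₃
    simp [min_eq_left (not_lt.1 h₂)]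
  · subst h₄
    simp [max_eq_right (not_lt.1 h₂)]
  · rfl

theorem bop_of_not {c : ℕ} (h : ¬ (1 ≤ c ∧ c < n)) (d : Fin n → P) : bop P n c d = d :=
  dif_neg h

theorem bop_bop_self (c : ℕ) (d : Fin n → P) : bop P n c (bop P n c d) = bop P n c d := by
  by_cases h : 1 ≤ c ∧ c < n
  · ext i
    have : c ≠ c - 1 := by omega
    simp only [bop_apply h, if_true, this, if_false]
    grind
  · simp [bop_of_not h]

theorem bop_comm {c e : ℕ} (hce : c + 2 ≤ e) (d : Fin n → P) :
    bop P n c (bop P n e d) = bop P n e (bop P n c d) := by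
  by_cases h : 1 ≤ c ∧ c < n
  · by_cases h' : 1 ≤ e ∧ e < n
    · ext i
      simp only [bop_apply h, bop_apply h']
      have h₁ : c ≠ e := by omega
      have h₂ : c - 1 ≠ e := by omega
      have h₃ : c ≠ e - 1 := by omega
      have h₄ : c - 1 ≠ e - 1 := by omega
      simp only [h₁, h₂, h₃, h₄, h₁.symm, h₂.symm, h₃.symm, h₄.symm, if_false]
      split_ifs <;> first | rfl | omega
    · simp [bop_of_not h']
  · simp [bop_of_not h]

theorem bop_braid (c : ℕ) (d : Fin n → P) :
    bop P n (c + 1) (bop P n c (bop P n (c + 1) d)) =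
      bop P n c (bop P n (c + 1) (bop P n c d)) := by
  by_cases h : 1 ≤ c ∧ c < n
  · by_cases h' : 1 ≤ c + 1 ∧ c + 1 < n
    · ext i
      have h₁ : c ≠ c - 1 := by omega
      have h₂ : c + 1 ≠ c - 1 := by omega
      have h₃ : c + 1 ≠ c := by omega
      simp only [bop_apply h, bop_apply h', Nat.add_sub_cancel, h₁, h₂, h₃, h₁.symm, h₂.symm,
        h₃.symm, if_true, if_false]
      grind
    · simp [bop_of_not h', bop_bop_self]
  · simp [bop_of_not h, bop_bop_self]

/-- The bubble-sort operator as an element of the monoid of self-maps of `P^n`. -/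
def bopEnd (P : Type*) [LinearOrder P] (n c : ℕ) : Function.End (Fin n → P) := bop P n c

theorem applyOps_eq_prod (L : List ℕ) (d : Fin n → P) :
    applyOps P n L d =
      (L.reverse.map (bopEnd P n)).prod d := by
  induction L generalizing d with
  | nil => rfl
  | cons c L ih =>
    simp only [List.reverse_cons, List.map_append, List.prod_append, List.map_cons, List.map_nil,
      List.prod_singleton]
    exact ih _

end BubbleSort

theorem sort_eq_filter_range' {S : Finset ℕ} {N : ℕ} (hS : ∀ i ∈ S, i < N) :
    S.sort (· ≤ ·) = (List.range' 0 N).filter (· ∈ S) := by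
  refine List.Perm.eq_of_pairwise' (Finset.pairwise_sort S _) ?_ ?_
  · exact (List.pairwise_le_range' (s := 0) (n := N)).filter _
  · refine (List.perm_ext_iff_of_nodup (Finset.sort_nodup S _)
      ((List.nodup_range' (s := 0) (n := N)).filter _)).2 fun a => ?_
    simpa using hS a

/-- The four equalities of a short pattern at index `j` and of its reflection: an equality
occurs at `j` before the reflection if and only if one occurs after it. -/
theorem tshort_equality_iff {k : ℕ} {x y z : ℕ → ℕ}
    (hxy : ∀ j, j ≤ k + 1 → x j ≥ y j ∧ y j > x (j + 1))
    (hyz : ∀ j, j ≤ k → y j > z j ∧ z j ≥ y (j + 1)) {j : ℕ} (hj : j ≤ k + 1) :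
    (tshort k x y z j = x (j + 1) ↔
      (x j = y j ∨ 1 ≤ j ∧ z (j - 1) = y j) ∧ (j ≤ k → z j ≤ x (j + 1))) ∧
    (j ≤ k → (tshort k x y z j = z j ↔
      (x j = y j ∨ 1 ≤ j ∧ z (j - 1) = y j) ∧ x (j + 1) ≤ z j)) := by
  have h := hxy j hj
  obtain _ | j := j
  · have h' := hyz 0 (by omega)
    simp only [tshort, if_true, Nat.zero_add] at h h' ⊢
    omega
  · have h' := hyz j (by omega)
    rcases Nat.lt_or_ge j k with hjk | hjk
    · have h'' := hyz (j + 1) (by omega)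
      simp only [tshort, Nat.add_sub_cancel, show j + 1 ≠ 0 by omega,
        show j + 1 ≠ k + 1 by omega, if_false]
      omega
    · obtain rfl : j = k := by omega
      simp only [tshort, Nat.add_sub_cancel, show j + 1 ≠ 0 by omega, if_false, if_true,
        Nat.add_assoc, Nat.reduceAdd] at h h' ⊢
      omega

/-- The Coxeter-monoid elements associated to a Δ-then-Γ short pattern and
to its middle-row reflection coincide. -/
theorem monoid_elements_agree (P : Type*) [LinearOrder P] (n k : ℕ) (hn : k + 3 ≤ n)
    (x y z : ℕ → ℕ)
    (hxy : ∀ j, j ≤ k + 1 → x j ≥ y j ∧ y j > x (j + 1))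
    (hyz : ∀ j, j ≤ k → y j > z j ∧ z j ≥ y (j + 1)) :
    let y' := tshort k x y z
    let HΔ : Finset ℕ := ((Finset.range (k + 2)).filter (fun j => x j = y j)).image (· + 1)
    let HΓ : Finset ℕ := ((Finset.range (k + 1)).filter (fun j => z j = y (j + 1))).image (· + 2)
    let HΓ' : Finset ℕ := ((Finset.range (k + 2)).filter (fun j => y' j = x (j + 1))).image (· + 1)
    let HΔ' : Finset ℕ := ((Finset.range (k + 1)).filter (fun j => y' j = z j)).image (· + 1)
    ∀ d : Fin n → P,
      applyOps P n (HΓ.sort (· ≤ ·)) (applyOps P n ((HΔ.sort (· ≤ ·)).reverse) d)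
        = applyOps P n ((HΔ'.sort (· ≤ ·)).reverse) (applyOps P n (HΓ'.sort (· ≤ ·)) d) := by
  intro y' HΔ HΓ HΓ' HΔ' d
  have hΔ : ∀ i, i ∈ HΔ ↔ 1 ≤ i ∧ i ≤ k + 2 ∧ x (i - 1) = y (i - 1) := by
    intro i
    simp only [HΔ, Finset.mem_image, Finset.mem_filter, Finset.mem_range]
    refine ⟨?_, fun h => ⟨i - 1, ⟨by omega, h.2.2⟩, by omega⟩⟩
    rintro ⟨j, ⟨hj, h⟩, rfl⟩
    exact ⟨by omega, by omega, h⟩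
  have hΓ : ∀ i, i ∈ HΓ ↔ 2 ≤ i ∧ i ≤ k + 2 ∧ z (i - 2) = y (i - 1) := by
    intro i
    simp only [HΓ, Finset.mem_image, Finset.mem_filter, Finset.mem_range]
    refine ⟨?_, fun h => ⟨i - 2, ⟨by omega, ?_⟩, by omega⟩⟩
    · rintro ⟨j, ⟨hj, h⟩, rfl⟩
      exact ⟨by omega, by omega, h⟩
    · rw [h.2.2]
      congr 1
      omega
  have hΓ' : ∀ i, i ∈ HΓ' ↔ 1 ≤ i ∧ i ≤ k + 2 ∧ (i ∈ HΔ ∨ i ∈ HΓ) ∧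
      (i ≤ k + 1 → z (i - 1) ≤ x i) := by
    intro i
    simp only [hΔ, hΓ]
    simp only [HΓ', Finset.mem_image, Finset.mem_filter, Finset.mem_range]
    constructor
    · rintro ⟨j, ⟨hj, h⟩, rfl⟩
      have := (tshort_equality_iff hxy hyz (Nat.le_of_lt_succ hj)).1.1 h
      simp only [Nat.add_sub_cancel, show j + 1 - 2 = j - 1 by omega]
      omega
    · rintro ⟨h₁, h₂, h₃⟩
      obtain ⟨j, rfl⟩ : ∃ j, i = j + 1 := ⟨i - 1, by omega⟩
      simp only [Nat.add_sub_cancel, show j + 1 - 2 = j - 1 by omega] at h₃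
      exact ⟨j, ⟨by omega, (tshort_equality_iff hxy hyz (by omega)).1.2 (by omega)⟩, rfl⟩
  have hΔ' : ∀ i, i ∈ HΔ' ↔ 1 ≤ i ∧ i ≤ k + 1 ∧ (i ∈ HΔ ∨ i ∈ HΓ) ∧ x i ≤ z (i - 1) := by
    intro i
    simp only [hΔ, hΓ]
    simp only [HΔ', Finset.mem_image, Finset.mem_filter, Finset.mem_range]
    constructor
    · rintro ⟨j, ⟨hj, h⟩, rfl⟩
      have := ((tshort_equality_iff hxy hyz (j := j) (by omega)).2 (by omega)).1 h
      simp only [Nat.add_sub_cancel, show j + 1 - 2 = j - 1 by omega]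
      omega
    · rintro ⟨h₁, h₂, h₃⟩
      obtain ⟨j, rfl⟩ : ∃ j, i = j + 1 := ⟨i - 1, by omega⟩
      simp only [Nat.add_sub_cancel, show j + 1 - 2 = j - 1 by omega] at h₃
      exact ⟨j, ⟨by omega, ((tshort_equality_iff hxy hyz (by omega)).2 (by omega)).2 (by omega)⟩,
        rfl⟩
  have hE : HΓ ∪ HΔ = HΓ' ∪ HΔ' := by
    ext i
    have h₁ := hΔ i
    have h₂ := hΓ i
    simp only [Finset.mem_union, hΔ', hΓ']
    have := le_total (x i) (z (i - 1))
    grind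
  have hN : ∀ i ∈ HΓ ∪ HΔ, i < k + 3 := by
    intro i
    simp only [Finset.mem_union, hΔ, hΓ]
    omega
  have hshift : ∀ i, i ∈ HΓ ∪ HΔ → i + 1 ∈ HΓ ∪ HΔ →
      (i ∈ HΓ' ↔ i + 1 ∈ HΓ) ∧ (i ∈ HΔ' ↔ i + 1 ∈ HΔ) := by
    intro i hi hi'
    rw [hΓ', hΔ', Or.comm, ← Finset.mem_union]
    simp only [hi, true_and]
    simp only [Finset.mem_union, hΔ, hΓ, Nat.add_sub_cancel,
      show i + 1 - 2 = i - 1 by omega] at hi hi' ⊢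
    have h₁ := hxy i (by omega)
    have h₂ := hyz (i - 1) (by omega)
    rw [Nat.sub_add_cancel (by omega)] at h₂
    omega
  have main := (descProd_mul_ascProd_aux (m := bopEnd P n)
    (fun c => funext (bop_bop_self c)) (fun c e h => funext (bop_comm h))
    (fun c => funext (bop_braid c)) hE hN (fun i h h' => (hshift i h h').1)
    (fun i h h' => (hshift i h h').2) (k + 3) 0 (by omega)).1
  have hlt : ∀ i, i ∈ HΓ' ∪ HΔ' → i < k + 3 := by rwa [← hE]
  rw [sort_eq_filter_range' fun i h => hN i (Finset.mem_union_left _ h),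
    sort_eq_filter_range' fun i h => hN i (Finset.mem_union_right _ h),
    sort_eq_filter_range' fun i h => hlt i (Finset.mem_union_left _ h),
    sort_eq_filter_range' fun i h => hlt i (Finset.mem_union_right _ h)]
  simp only [applyOps_eq_prod, List.reverse_reverse]
  exact congrFun main d

end CoxeterMonoid
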